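/- arXiv:2506.12624 — 7 statements merged into one kernel-verified Lean document; each statement's English description precedes it below -/
import Mathlib

section
/- Let A be a real symmetric n×n matrix (viewed as a complex matrix), let Y be a real diagonal n×n matrix whose diagonal entries all lie in the interval [0,1], and let z₁, z₂ ∈ ℂ with Im z₁ > 0 and Im z₂ > 0. Then (A − z₁·Y − z₂·(I − Y)) is invertible and the (1,1) entry of its inverse has strictly positive imaginary part: Im(((A − z₁·Y − z₂·(I − Y))⁻¹)₁₁) > 0. -/
open scoped Matrix in
theorem quad_im_aux {n : ℕ} (A : Matrix (Fin n) (Fin n) ℝ) (hA : A.IsSymm)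
    (d : Fin n → ℝ) (hd : ∀ i, d i ∈ Set.Icc (0 : ℝ) 1)
    (z₁ z₂ : ℂ) (h₁ : 0 < z₁.im) (h₂ : 0 < z₂.im) (x : Fin n → ℂ) (hx : x ≠ 0) :
    (star x ⬝ᵥ (A.map Complex.ofReal
      - z₁ • Matrix.diagonal (fun i => (d i : ℂ))
      - z₂ • ((1 : Matrix (Fin n) (Fin n) ℂ) - Matrix.diagonal (fun i => (d i : ℂ)))).mulVec x).im
      < 0 := by
  have hH : (A.map Complex.ofReal).IsHermitian := by
    ext i j
    simp [Matrix.conjTranspose_apply, hA.apply i j]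
  have hM : (A.map Complex.ofReal
      - z₁ • Matrix.diagonal (fun i => (d i : ℂ))
      - z₂ • ((1 : Matrix (Fin n) (Fin n) ℂ) - Matrix.diagonal (fun i => (d i : ℂ))))
      = A.map Complex.ofReal - Matrix.diagonal (fun i => z₁ * d i + z₂ * (1 - d i)) := by
    ext i j
    by_cases h : i = j
    · subst h
      simp
      ring
    · simp [h]
  have h0 : (star x ⬝ᵥ (A.map Complex.ofReal).mulVec x).im = 0 :=
    hH.im_star_dotProduct_mulVec_self x
  rw [hM, Matrix.sub_mulVec, dotProduct_sub, Complex.sub_im, h0, zero_sub, neg_lt_zero]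
  have hs : (star x ⬝ᵥ (Matrix.diagonal (fun i => z₁ * d i + z₂ * (1 - d i))).mulVec x).im
      = ∑ i, (z₁.im * d i + z₂.im * (1 - d i)) * Complex.normSq (x i) := by
    simp only [dotProduct, Matrix.mulVec_diagonal, Complex.im_sum]
    refine Finset.sum_congr rfl fun i _ => ?_
    simp [Complex.normSq_apply]
    ring
  have hw : ∀ i, 0 < z₁.im * d i + z₂.im * (1 - d i) := by
    intro i
    obtain ⟨ha, hb⟩ := hd i
    rcases ha.eq_or_lt with h | h
    · rw [← h]; simpa using h₂
    · have := mul_pos h₁ h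
      have := mul_nonneg h₂.le (sub_nonneg.2 hb)
      linarith
  rw [hs]
  obtain ⟨i, hi⟩ := Function.ne_iff.1 hx
  exact Finset.sum_pos' (fun j _ => mul_nonneg (hw j).le (Complex.normSq_nonneg _))
    ⟨i, Finset.mem_univ i, mul_pos (hw i) (Complex.normSq_pos.2 hi)⟩

/-- If `A` is a real symmetric matrix (viewed as complex), `Y` is a real
diagonal matrix with diagonal entries in `[0,1]`, and `Im z₁ > 0`, `Im z₂ > 0`, then
`M = A - z₁ Y - z₂ (I - Y)` is invertible and `Im ((M⁻¹)₁₁) > 0`. -/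
theorem inv_entry_one_one_im_pos (n : ℕ) (hn : 0 < n)
    (A : Matrix (Fin n) (Fin n) ℝ) (hA : A.IsSymm)
    (d : Fin n → ℝ) (hd : ∀ i, d i ∈ Set.Icc (0 : ℝ) 1)
    (z₁ z₂ : ℂ) (h₁ : 0 < z₁.im) (h₂ : 0 < z₂.im) :
    let M : Matrix (Fin n) (Fin n) ℂ := A.map Complex.ofReal
      - z₁ • Matrix.diagonal (fun i => (d i : ℂ))
      - z₂ • ((1 : Matrix (Fin n) (Fin n) ℂ) - Matrix.diagonal (fun i => (d i : ℂ)))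
    IsUnit M ∧ 0 < (M⁻¹ ⟨0, hn⟩ ⟨0, hn⟩).im := by
  intro M
  have key := quad_im_aux A hA d hd z₁ z₂ h₁ h₂
  change ∀ x : Fin n → ℂ, x ≠ 0 → (star x ⬝ᵥ M.mulVec x).im < 0 at key
  have hdet : M.det ≠ 0 := by
    intro h
    obtain ⟨v, hv, hv0⟩ := Matrix.exists_mulVec_eq_zero_iff.2 h
    have := key v hv
    rw [hv0] at this
    simp at this
  have hU : IsUnit M.det := isUnit_iff_ne_zero.2 hdet
  refine ⟨(Matrix.isUnit_iff_isUnit_det M).2 hU, ?_⟩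
  have hMx : M.mulVec (M⁻¹.mulVec (Pi.single ⟨0, hn⟩ 1)) = Pi.single ⟨0, hn⟩ 1 := by
    rw [Matrix.mulVec_mulVec, Matrix.mul_nonsing_inv _ hU, Matrix.one_mulVec]
  have hx : M⁻¹.mulVec (Pi.single ⟨0, hn⟩ 1) ≠ 0 := by
    intro h
    rw [h, Matrix.mulVec_zero] at hMx
    have := congrFun hMx ⟨0, hn⟩
    simp at this
  have := key _ hx
  rw [hMx] at this
  simpa using this
end

section
/- Let G be a finite simple graph on vertex set {1,…,n} with n ≥ 2 and adjacency matrix A (regarded as a complex n×n matrix), let t ∈ [0,1), let Y_t = diag(1,…,1,t), and write z_Y := z₁·Y_t + z₂·(I − Y_t). If vertices 1 and n lie in different connected components of G (i.e., there is no path in G from vertex 1 to vertex n), then ((A − z_Y)⁻¹)₁₁ does not depend on z₂: for all z₁ ∈ ℍ and all z₂, z₂′ ∈ ℍ, the matrices A − z₁·Y_t − z₂·(I − Y_t) and A − z₁·Y_t − z₂′·(I − Y_t) are invertible and the (1,1) entries of their inverses are equal. -/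
open Matrix in
theorem aux_isUnit {n : ℕ} (G : SimpleGraph (Fin n)) [DecidableRel G.Adj]
    (d : Fin n → ℂ) (hd : ∀ k, 0 < (d k).im) :
    IsUnit (G.adjMatrix ℂ - Matrix.diagonal d) := by
  rw [← Matrix.mulVec_injective_iff_isUnit]
  have key : ∀ v : Fin n → ℂ, (G.adjMatrix ℂ - Matrix.diagonal d) *ᵥ v = 0 → v = 0 := by
    intro v hv
    have hA : (G.adjMatrix ℂ).IsHermitian := by
      ext i j
      simp [SimpleGraph.adjMatrix_apply, G.adj_comm, apply_ite]
    have h1 : (star v ⬝ᵥ (G.adjMatrix ℂ *ᵥ v)).im = 0 := hA.im_star_dotProduct_mulVec_self v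
    have h2 : G.adjMatrix ℂ *ᵥ v = Matrix.diagonal d *ᵥ v := by
      rw [Matrix.sub_mulVec] at hv
      exact sub_eq_zero.mp hv
    have h3 : (star v ⬝ᵥ (Matrix.diagonal d *ᵥ v)).im = ∑ k, (d k).im * Complex.normSq (v k) := by
      simp only [dotProduct, Matrix.mulVec_diagonal, Complex.im_sum]
      refine Finset.sum_congr rfl fun k _ => ?_
      simp [Complex.normSq_apply]
      ring
    rw [h2, h3] at h1
    rw [Finset.sum_eq_zero_iff_of_nonneg
      (fun k _ => mul_nonneg (hd k).le (Complex.normSq_nonneg _))] at h1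
    funext k
    have := h1 k (Finset.mem_univ k)
    rcases mul_eq_zero.mp this with h | h
    · exact absurd h (hd k).ne'
    · exact Complex.normSq_eq_zero.mp h
  intro v w hvw
  apply sub_eq_zero.mp
  apply key
  rw [Matrix.mulVec_sub]
  exact sub_eq_zero.mpr hvw

/-- If vertices `1` and `n` of a simple graph `G` on `{1, …, n}` are not
path connected, then `((A - z_Y)⁻¹)₁₁` does not depend on `z₂`: for `z₁, z₂, z₂'` in the
upper half-plane, both matrices `A - z₁ Y_t - z₂ (I - Y_t)` and `A - z₁ Y_t - z₂' (I - Y_t)`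
are invertible and the `(1,1)` entries of their inverses agree. -/
theorem not_connected_inv_entry_indep (n : ℕ) (hn : 2 ≤ n)
    (G : SimpleGraph (Fin n)) [DecidableRel G.Adj]
    (t : ℝ) (ht0 : 0 ≤ t) (ht1 : t < 1)
    (hnreach : ¬ G.Reachable ⟨0, by omega⟩ ⟨n - 1, by omega⟩)
    (z₁ z₂ z₂' : ℂ) (h₁ : 0 < z₁.im) (h₂ : 0 < z₂.im) (h₂' : 0 < z₂'.im) :
    let A : Matrix (Fin n) (Fin n) ℂ := G.adjMatrix ℂ
    let Y : Matrix (Fin n) (Fin n) ℂ :=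
      Matrix.diagonal (fun k => if k.1 = n - 1 then (t : ℂ) else 1)
    let M : Matrix (Fin n) (Fin n) ℂ := A - z₁ • Y - z₂ • (1 - Y)
    let M' : Matrix (Fin n) (Fin n) ℂ := A - z₁ • Y - z₂' • (1 - Y)
    IsUnit M ∧ IsUnit M' ∧
      M⁻¹ ⟨0, by omega⟩ ⟨0, by omega⟩ = M'⁻¹ ⟨0, by omega⟩ ⟨0, by omega⟩ := by
  classical
  intro A Y M M'
  have hU : ∀ z : ℂ, 0 < z.im → IsUnit (A - z₁ • Y - z • (1 - Y)) := by
    intro z hz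
    have e : A - z₁ • Y - z • (1 - Y) = G.adjMatrix ℂ - Matrix.diagonal (fun k : Fin n =>
        if k.1 = n - 1 then z₁ * t + z * (1 - t) else z₁) := by
      ext i j
      by_cases hij : i = j
      · subst hij
        by_cases hi : i.1 = n - 1 <;> simp [A, Y, hi]
        ring
      · simp [A, Y, hij]
    rw [e]
    apply aux_isUnit
    intro k
    split_ifs
    · simp
      nlinarith [mul_nonneg h₁.le ht0, mul_pos hz (sub_pos.mpr ht1)]
    · exact h₁
  have hM : IsUnit M := hU z₂ h₂
  have hM' : IsUnit M' := hU z₂' h₂'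
  refine ⟨hM, hM', ?_⟩
  let D : Matrix (Fin n) (Fin n) ℂ :=
    Matrix.diagonal (fun k => if G.Reachable ⟨0, by omega⟩ k then 1 else 0)
  have hD : D * M' = M * D := by
    ext i j
    simp only [D, Matrix.diagonal_mul, Matrix.mul_diagonal]
    by_cases hij : i = j
    · subst hij
      by_cases hi : i.1 = n - 1
      · have : i = ⟨n - 1, by omega⟩ := Fin.ext hi
        rw [this]
        simp [hnreach]
      · simp [M, M', A, Y, hi]
        split_ifs <;> simp
    · by_cases hadj : G.Adj i j
      · have : G.Reachable ⟨0, by omega⟩ i ↔ G.Reachable ⟨0, by omega⟩ j :=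
          ⟨fun h => h.trans hadj.reachable, fun h => h.trans hadj.symm.reachable⟩
        simp [M, M', A, Y, hij, this, hadj]
      · simp [M, M', A, Y, hij, hadj]
  have hfin : M⁻¹ * D = D * M'⁻¹ := by
    have d1 := (Matrix.isUnit_iff_isUnit_det _).mp hM
    have d2 := (Matrix.isUnit_iff_isUnit_det _).mp hM'
    calc M⁻¹ * D = M⁻¹ * (D * M') * M'⁻¹ := by
          rw [Matrix.mul_assoc, Matrix.mul_assoc D, Matrix.mul_nonsing_inv _ d2, Matrix.mul_one]
      _ = D * M'⁻¹ := by
          rw [hD, ← Matrix.mul_assoc, Matrix.nonsing_inv_mul _ d1, Matrix.one_mul]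
  have := congrFun (congrFun hfin ⟨0, by omega⟩) ⟨0, by omega⟩
  simpa [D, Matrix.diagonal_mul, Matrix.mul_diagonal] using this
end

section
/- Let G be a finite simple graph on vertex set {1,…,n} with n ≥ 3 and adjacency matrix A regarded as a real n×n matrix. Let A₂ be the principal submatrix of A on rows and columns 1,…,n−1, let A₃ be the principal submatrix of A on rows and columns 2,…,n−1, let γ ∈ ℝ^{n−1} be given by γ_i = A_{i,n} for 1 ≤ i ≤ n−1, and let η ∈ ℝ^{n−2} be given by η_i = A_{i+1,n} for 1 ≤ i ≤ n−2. If vertices 1 and n are joined by a path in G, then there exists m ∈ ℕ such that γᵀ A₂^m γ ≠ ηᵀ A₃^m η. -/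
open scoped Matrix

theorem aux_nonneg {k : ℕ} (B : Matrix (Fin k) (Fin k) ℝ) (g : Fin k → ℝ)
    (hB : ∀ i j, 0 ≤ B i j) (hg : ∀ i, 0 ≤ g i) (m : ℕ) : ∀ i, 0 ≤ ((B ^ m) *ᵥ g) i := by
  induction m with
  | zero => simpa using hg
  | succ m ih =>
    intro i
    rw [pow_succ', ← Matrix.mulVec_mulVec]
    have h : 0 ≤ ∑ j, B i j * ((B ^ m) *ᵥ g) j :=
      Finset.sum_nonneg fun j _ => mul_nonneg (hB i j) (ih j)
    exact h

theorem aux_le {k : ℕ} (B : Matrix (Fin (k+1)) (Fin (k+1)) ℝ) (g : Fin (k+1) → ℝ)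
    (hB : ∀ i j, 0 ≤ B i j) (hg : ∀ i, 0 ≤ g i) (m : ℕ) : ∀ i : Fin k,
    (((B.submatrix Fin.succ Fin.succ) ^ m) *ᵥ (fun i => g i.succ)) i ≤ ((B ^ m) *ᵥ g) i.succ := by
  induction m with
  | zero => simp
  | succ m ih =>
    intro i
    rw [pow_succ', ← Matrix.mulVec_mulVec, pow_succ', ← Matrix.mulVec_mulVec]
    simp only [Matrix.mulVec, dotProduct, Fin.sum_univ_succ (n := k), Matrix.submatrix_apply]
    have h0 : 0 ≤ B i.succ 0 * ((B ^ m) *ᵥ g) 0 :=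
      mul_nonneg (hB _ _) (aux_nonneg B g hB hg m 0)
    have h1 : ∑ j : Fin k, B i.succ j.succ *
        (((B.submatrix Fin.succ Fin.succ) ^ m) *ᵥ (fun i => g i.succ)) j
        ≤ ∑ j : Fin k, B i.succ j.succ * ((B ^ m) *ᵥ g) j.succ :=
      Finset.sum_le_sum fun j _ => mul_le_mul_of_nonneg_left (ih j) (hB _ _)
    simp only [Matrix.mulVec, dotProduct, Fin.sum_univ_succ (n := k)] at h0 h1
    linarith

theorem aux_sq {k : ℕ} (B : Matrix (Fin k) (Fin k) ℝ) (g : Fin k → ℝ)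
    (hB : Bᵀ = B) (m : ℕ) :
    g ⬝ᵥ ((B ^ (m + m)) *ᵥ g) = ((B ^ m) *ᵥ g) ⬝ᵥ ((B ^ m) *ᵥ g) := by
  rw [pow_add, ← Matrix.mulVec_mulVec, Matrix.dotProduct_mulVec, ← Matrix.mulVec_transpose,
    Matrix.transpose_pow, hB]

theorem aux_main {k : ℕ} (B : Matrix (Fin (k+1)) (Fin (k+1)) ℝ) (g : Fin (k+1) → ℝ)
    (hB : ∀ i j, 0 ≤ B i j) (hg : ∀ i, 0 ≤ g i) (hs : Bᵀ = B) (m : ℕ)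
    (hm : 0 < ((B ^ m) *ᵥ g) 0) :
    g ⬝ᵥ ((B ^ (m + m)) *ᵥ g) ≠ (fun i : Fin k => g i.succ) ⬝ᵥ
      (((B.submatrix Fin.succ Fin.succ) ^ (m + m)) *ᵥ (fun i => g i.succ)) := by
  rw [aux_sq B g hs, aux_sq _ _ (by rw [Matrix.transpose_submatrix, hs])]
  have h1 := aux_le B g hB hg m
  have h2 := aux_nonneg (B.submatrix Fin.succ Fin.succ) (fun i => g i.succ)
    (fun i j => hB _ _) (fun i => hg _) m
  generalize (B ^ m) *ᵥ g = v at *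
  generalize (B.submatrix Fin.succ Fin.succ ^ m *ᵥ fun i => g i.succ) = w at *
  apply ne_of_gt
  simp only [dotProduct]
  rw [Fin.sum_univ_succ]
  have : ∑ i, w i * w i ≤ ∑ i : Fin k, v i.succ * v i.succ :=
    Finset.sum_le_sum fun i _ => mul_self_le_mul_self (h2 i) (h1 i)
  have := mul_pos hm hm
  linarith

theorem aux_walk {k : ℕ} (G : SimpleGraph (Fin (k+2))) [DecidableRel G.Adj]
    (B : Matrix (Fin (k+1)) (Fin (k+1)) ℝ) (g : Fin (k+1) → ℝ)
    (hB : ∀ i j, B i j = G.adjMatrix ℝ i.castSucc j.castSucc)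
    (hg : ∀ i, g i = G.adjMatrix ℝ i.castSucc (Fin.last _))
    (hB0 : ∀ i j, 0 ≤ B i j) (hg0 : ∀ i, 0 ≤ g i) {u w : Fin (k+2)} (p : G.Walk u w) :
    w = Fin.last _ → ∀ i : Fin (k+1), u = i.castSucc → ∃ m, 0 < ((B ^ m) *ᵥ g) i := by
  induction p with
  | nil =>
    intro h i hi
    exact absurd (hi.symm.trans h) (Fin.castSucc_lt_last i).ne
  | @cons u v w hadj p ih =>
    rintro h i rfl
    rcases Fin.eq_castSucc_or_eq_last v with ⟨j, rfl⟩ | rfl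
    · obtain ⟨m, hm⟩ := ih h j rfl
      refine ⟨m + 1, ?_⟩
      rw [pow_succ', ← Matrix.mulVec_mulVec]
      refine Finset.sum_pos' (fun l _ => mul_nonneg (hB0 i l) (aux_nonneg B g hB0 hg0 m l))
        ⟨j, Finset.mem_univ _, mul_pos ?_ hm⟩
      rw [hB]
      simp [hadj]
    · refine ⟨0, ?_⟩
      simp [hg, hadj]

/-- Let `G` be a simple graph on `{1, …, n}` (`n ≥ 3`) with real adjacency
matrix `A`, `A₂` its principal submatrix on rows/columns `1, …, n-1`, `A₃` its principal
submatrix on rows/columns `2, …, n-1`, `γ` the last column of `A` without its last entry,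
and `η` the last column of `A` without its first and last entries.  If vertices `1` and `n`
are path connected, then `γᵀ A₂^m γ ≠ ηᵀ A₃^m η` for some `m`. -/
theorem exists_power_dotProduct_ne (n : ℕ) (hn : 3 ≤ n)
    (G : SimpleGraph (Fin n)) [DecidableRel G.Adj]
    (hreach : G.Reachable ⟨0, by omega⟩ ⟨n - 1, by omega⟩) :
    let A : Matrix (Fin n) (Fin n) ℝ := G.adjMatrix ℝ
    let A₂ : Matrix (Fin (n - 1)) (Fin (n - 1)) ℝ :=
      A.submatrix (fun i => (⟨i.1, by have := i.isLt; omega⟩ : Fin n))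
        (fun j => (⟨j.1, by have := j.isLt; omega⟩ : Fin n))
    let A₃ : Matrix (Fin (n - 2)) (Fin (n - 2)) ℝ :=
      A.submatrix (fun i => (⟨i.1 + 1, by have := i.isLt; omega⟩ : Fin n))
        (fun j => (⟨j.1 + 1, by have := j.isLt; omega⟩ : Fin n))
    let γ : Fin (n - 1) → ℝ :=
      fun i => A ⟨i.1, by have := i.isLt; omega⟩ ⟨n - 1, by omega⟩
    let η : Fin (n - 2) → ℝ :=
      fun i => A ⟨i.1 + 1, by have := i.isLt; omega⟩ ⟨n - 1, by omega⟩
    ∃ m : ℕ, γ ⬝ᵥ ((A₂ ^ m) *ᵥ γ) ≠ η ⬝ᵥ ((A₃ ^ m) *ᵥ η) := by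
  obtain ⟨k, rfl⟩ : ∃ k, n = k + 2 := ⟨n - 2, by omega⟩
  intro A A₂ A₃ γ η
  have hA : ∀ i j, 0 ≤ A i j := fun i j => by
    simp only [A, SimpleGraph.adjMatrix_apply]
    split_ifs <;> norm_num
  obtain ⟨p⟩ := hreach
  have hB0 : ∀ i j, 0 ≤ A₂ i j := fun i j => hA _ _
  have hg0 : ∀ i, 0 ≤ γ i := fun i => hA _ _
  obtain ⟨m, hm⟩ := aux_walk G A₂ γ (fun i j => rfl) (fun i => rfl) hB0 hg0 p rfl 0 rfl
  have hs : A₂ᵀ = A₂ := by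
    simp only [A₂, Matrix.transpose_submatrix, A, SimpleGraph.transpose_adjMatrix]
  exact ⟨m + m, aux_main (k := k) A₂ γ hB0 hg0 hs m hm⟩
end

section
/- Let G be a finite simple graph on vertex set {1,…,n} with n ≥ 2 and adjacency matrix A, and suppose vertices 1 and n are joined by a path in G. Let ẑ_Y denote the n×n diagonal matrix with diagonal entries (−1/z₁, −1/z₁, …, −1/z₁, z₂). Then there exist polynomials q₁, q₂ ∈ ℂ[z₁, z₂] with q₂ not identically zero, having no common nonconstant polynomial factor, such that q₁(0,0) = 0 = q₂(0,0) and such that q₂(z₁,z₂)·((A − ẑ_Y)⁻¹)₁₁ = q₁(z₁,z₂) for every (z₁,z₂) ∈ ℂ² with z₁ ≠ 0 for which A − ẑ_Y is invertible and q₂(z₁,z₂) ≠ 0. -/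
open MvPolynomial in
theorem aux_degreeOf_det {n : ℕ} (l : Fin n) (M : Matrix (Fin n) (Fin n) (MvPolynomial (Fin 2) ℂ))
    (h : ∀ i j, degreeOf 1 (M i j) ≤ if j = l then 1 else 0) : degreeOf 1 M.det ≤ 1 := by
  rw [Matrix.det_apply']
  refine (degreeOf_sum_le _ _ _).trans (Finset.sup_le fun σ _ => ?_)
  refine (degreeOf_mul_le _ _ _).trans ?_
  have h1 : degreeOf (1 : Fin 2) (((Equiv.Perm.sign σ : ℤ) : MvPolynomial (Fin 2) ℂ)) = 0 := by
    have : (((Equiv.Perm.sign σ : ℤ) : MvPolynomial (Fin 2) ℂ)) = C ((Equiv.Perm.sign σ : ℤ) : ℂ) := by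
      simp
    rw [this, degreeOf_C]
  rw [h1, zero_add]
  refine (degreeOf_prod_le _ _ _).trans ?_
  refine (Finset.sum_le_sum fun i _ => h (σ i) i).trans ?_
  simp

open MvPolynomial in
theorem aux_eval_indep (p : MvPolynomial (Fin 2) ℂ) (h : degreeOf 1 p = 0) (v w : Fin 2 → ℂ)
    (hvw : v 0 = w 0) : eval v p = eval w p := by
  refine eval₂Hom_congr' rfl ?_ rfl
  intro i hi _
  have : i ≠ 1 := by
    rintro rfl
    rw [mem_vars] at hi
    obtain ⟨d, hd, hd1⟩ := hi
    have := monomial_le_degreeOf (1 : Fin 2) hd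
    simp at hd1
    omega
  have : i = 0 := by omega
  rw [this, hvw]

/-- Strict positivity of solutions. -/
theorem aux_pos {n : ℕ} (G : SimpleGraph (Fin n)) [DecidableRel G.Adj] (o l : Fin n)
    (hreach : G.Reachable o l) (D : Fin n → ℝ) (hD : ∀ i, (n : ℝ) < D i) (u : Fin n → ℝ)
    (hu : ∀ i, D i * u i = (if i = o then 1 else 0) + ∑ j, (if G.Adj i j then u j else 0)) :
    0 < u l := by
  have hnn : ∀ i, 0 ≤ u i := by
    obtain ⟨m, -, hm⟩ := Finset.exists_min_image Finset.univ u ⟨o, Finset.mem_univ _⟩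
    have : 0 ≤ u m := by
      by_contra! hneg
      have h1 : (n : ℝ) * u m ≤ ∑ j, (if G.Adj m j then u j else 0) := by
        have : ∑ j : Fin n, u m ≤ ∑ j, (if G.Adj m j then u j else 0) := by
          refine Finset.sum_le_sum fun j _ => ?_
          split_ifs
          · exact hm j (Finset.mem_univ _)
          · exact hneg.le
        simpa using this
      have h2 := hu m
      have h3 : (0:ℝ) ≤ if m = o then 1 else 0 := by split_ifs <;> norm_num
      nlinarith [hD m]
    exact fun i => this.trans (hm i (Finset.mem_univ _))
  have hDp : ∀ i, 0 < D i := fun i => lt_of_le_of_lt (Nat.cast_nonneg n) (hD i)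
  have hsum : ∀ i, 0 ≤ ∑ j, (if G.Adj i j then u j else 0) := fun i =>
    Finset.sum_nonneg fun j _ => by split_ifs <;> simp [hnn]
  have ho : 0 < u o := by
    have h := hu o
    have h2 := hsum o
    simp only [if_true] at h
    by_contra! h3
    nlinarith [hDp o]
  have hstep : ∀ i j, G.Adj i j → 0 < u i → 0 < u j := by
    intro i j hij hi
    have h := hu j
    have h2 : u i ≤ ∑ k, (if G.Adj j k then u k else 0) := by
      have := Finset.single_le_sum (f := fun k => if G.Adj j k then u k else 0)
        (fun k _ => by split_ifs <;> simp [hnn]) (Finset.mem_univ i)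
      simpa [hij.symm] using this
    have h3 : (0:ℝ) ≤ if j = o then 1 else 0 := by split_ifs <;> norm_num
    by_contra! h4
    nlinarith [hDp j]
  obtain ⟨p⟩ := hreach
  clear hu
  induction p with
  | nil => exact ho
  | cons hadj _ ih => exact ih (hstep _ _ hadj ho)

/-- Invertibility and nonvanishing of the corner entry. -/
theorem aux_mat {n : ℕ} (G : SimpleGraph (Fin n)) [DecidableRel G.Adj] (o l : Fin n)
    (hreach : G.Reachable o l) (D : Fin n → ℝ) (hD : ∀ i, (n : ℝ) < D i)
    (M : Matrix (Fin n) (Fin n) ℂ)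
    (hM : M = G.adjMatrix ℂ - Matrix.diagonal (fun k => (D k : ℂ))) :
    IsUnit M ∧ M⁻¹ l o ≠ 0 ∧ M⁻¹ o l ≠ 0 := by
  have hDp : ∀ i, 0 < D i := fun i => lt_of_le_of_lt (Nat.cast_nonneg n) (hD i)
  have hdet : M.det ≠ 0 := by
    apply det_ne_zero_of_sum_row_lt_diag
    intro k
    have h1 : ‖M k k‖ = D k := by
      simp [hM, abs_of_pos (hDp k)]
    rw [h1]
    refine lt_of_le_of_lt ?_ (hD k)
    have h2 : ∑ j ∈ Finset.univ.erase k, ‖M k j‖ ≤ ∑ j ∈ Finset.univ.erase k, (1:ℝ) := by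
      refine Finset.sum_le_sum fun j hj => ?_
      have hjk : k ≠ j := (Finset.ne_of_mem_erase hj).symm
      simp only [hM, Matrix.sub_apply, SimpleGraph.adjMatrix_apply, Matrix.diagonal_apply_ne _ hjk, sub_zero]
      split_ifs <;> simp
    refine h2.trans ?_
    simp only [Finset.sum_const, nsmul_eq_mul, mul_one]
    exact_mod_cast (Finset.card_le_univ _).trans (by simp)
  have hU : IsUnit M.det := isUnit_iff_ne_zero.mpr hdet
  have hlo : M⁻¹ l o ≠ 0 := by
    intro h0
    have hmul := Matrix.mul_nonsing_inv M hU
    have := aux_pos G o l hreach D hD (fun i => - (M⁻¹ i o).re) (by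
      intro i
      have h := congrFun (congrFun hmul i) o
      nth_rewrite 1 [hM] at h
      rw [Matrix.sub_mul, Matrix.sub_apply, Matrix.diagonal_mul, Matrix.mul_apply, Matrix.one_apply] at h
      have h' := congrArg Complex.re h
      rw [Complex.sub_re, Complex.re_ofReal_mul, Complex.re_sum] at h'
      have e1 : ∀ j, (G.adjMatrix ℂ i j * M⁻¹ j o).re = -(if G.Adj i j then -(M⁻¹ j o).re else 0) := by
        intro j
        rw [SimpleGraph.adjMatrix_apply]
        split_ifs <;> simp
      rw [Finset.sum_congr rfl fun j _ => e1 j, Finset.sum_neg_distrib] at h'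
      have e2 : ((if i = o then 1 else 0 : ℂ)).re = if i = o then 1 else 0 := by
        split_ifs <;> simp
      rw [e2] at h'
      linarith)
    simp [h0] at this
  refine ⟨(Matrix.isUnit_iff_isUnit_det M).mpr hU, hlo, ?_⟩
  have hs : M.transpose = M := by
    rw [hM]; simp
  have : M⁻¹ o l = M⁻¹ l o := by
    rw [← Matrix.transpose_apply M⁻¹, Matrix.transpose_nonsing_inv, hs]
  rwa [this]

/-- The row-scaled polynomial matrix. -/
noncomputable def auxT {n : ℕ} (G : SimpleGraph (Fin n)) [DecidableRel G.Adj] (l : Fin n) :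
    Matrix (Fin n) (Fin n) (MvPolynomial (Fin 2) ℂ) := fun i j =>
  if i = l then MvPolynomial.C (G.adjMatrix ℂ i j) - (if i = j then MvPolynomial.X 1 else 0)
  else MvPolynomial.X 0 * MvPolynomial.C (G.adjMatrix ℂ i j) + (if i = j then 1 else 0)

open MvPolynomial in
theorem auxT_deg {n : ℕ} (G : SimpleGraph (Fin n)) [DecidableRel G.Adj] (l : Fin n) (i j : Fin n) :
    degreeOf 1 (auxT G l i j) ≤ if j = l then 1 else 0 := by
  have hx : degreeOf (1 : Fin 2) (X 0 * C (G.adjMatrix ℂ i j) : MvPolynomial (Fin 2) ℂ) ≤ 0 := by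
    refine (degreeOf_mul_le _ _ _).trans ?_
    rw [degreeOf_C, degreeOf_X]; simp
  unfold auxT
  by_cases hi : i = l
  · by_cases hij : i = j
    · have : j = l := hij ▸ hi
      simp only [hi, this, if_true]
      refine (degreeOf_sub_le _ _ _).trans ?_
      rw [degreeOf_C, degreeOf_X]; simp
    · simp only [hi, if_true]
      rw [hi] at hij
      rw [if_neg hij, sub_zero, degreeOf_C]
      simp
  · simp only [hi, if_false]
    refine le_trans ?_ (Nat.zero_le _)
    refine (degreeOf_add_le _ _ _).trans ?_
    refine max_le hx ?_
    split_ifs <;> simp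

open MvPolynomial in
theorem auxT_adj_deg {n : ℕ} (G : SimpleGraph (Fin n)) [DecidableRel G.Adj] (l o : Fin n) :
    degreeOf 1 (X 0 * (auxT G l).adjugate o o) ≤ 1 := by
  refine (degreeOf_mul_le _ _ _).trans ?_
  have h : degreeOf 1 ((auxT G l).adjugate o o) ≤ 1 := by
    rw [Matrix.adjugate_apply]
    apply aux_degreeOf_det l
    intro i j
    by_cases hi : i = o
    · subst hi
      rw [Matrix.updateRow_self]
      refine le_trans ?_ (Nat.zero_le _)
      rw [Pi.single_apply]
      split_ifs <;> simp
    · rw [Matrix.updateRow_ne hi]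
      exact auxT_deg G l i j
  rw [degreeOf_X]
  simpa using h

open MvPolynomial in
theorem auxT_eval {n : ℕ} (G : SimpleGraph (Fin n)) [DecidableRel G.Adj] (l : Fin n)
    (z₁ z₂ : ℂ) (hz : z₁ ≠ 0) :
    (auxT G l).map (eval (fun i : Fin 2 => if i = 0 then z₁ else z₂)) =
      Matrix.diagonal (fun i => if i = l then 1 else z₁) *
      (G.adjMatrix ℂ - Matrix.diagonal (fun k : Fin n => if k = l then z₂ else -1 / z₁)) := by
  ext i j
  rw [Matrix.diagonal_mul, Matrix.map_apply, Matrix.sub_apply, Matrix.diagonal_apply]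
  unfold auxT
  by_cases hi : i = l <;> by_cases hij : i = j <;> simp [hi, hij]
  · subst hi; subst hij; simp
  · rw [hi] at hij; simp [hij]
  · have : j ≠ l := hij ▸ hi
    simp [this]
    field_simp
  · split_ifs <;> simp
  

open MvPolynomial in
theorem auxT_main {n : ℕ} (G : SimpleGraph (Fin n)) [DecidableRel G.Adj] (l o : Fin n) (hol : o ≠ l)
    (z₁ z₂ : ℂ) (hz : z₁ ≠ 0) (M : Matrix (Fin n) (Fin n) ℂ)
    (hM : M = G.adjMatrix ℂ - Matrix.diagonal (fun k : Fin n => if k = l then z₂ else -1 / z₁))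
    (hU : IsUnit M) :
    eval (fun i : Fin 2 => if i = 0 then z₁ else z₂) (auxT G l).det ≠ 0 ∧
    eval (fun i : Fin 2 => if i = 0 then z₁ else z₂) (auxT G l).det * M⁻¹ o o =
    eval (fun i : Fin 2 => if i = 0 then z₁ else z₂) (X 0 * (auxT G l).adjugate o o) := by
  have hT := auxT_eval G l z₁ z₂ hz
  rw [← hM] at hT
  set e := eval (fun i : Fin 2 => if i = 0 then z₁ else z₂) with he
  have hUd := (Matrix.isUnit_iff_isUnit_det M).mp hU
  have hd : e (auxT G l).det = ((auxT G l).map e).det := by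
    rw [RingHom.map_det]; rfl
  have ha : e ((auxT G l).adjugate o o) = ((auxT G l).map e).adjugate o o := by
    have := congrFun (congrFun (RingHom.map_adjugate e (auxT G l)) o) o
    simpa using this
  constructor
  · rw [hd, hT, Matrix.det_mul, Matrix.det_diagonal]
    refine mul_ne_zero (Finset.prod_ne_zero_iff.mpr fun i _ => ?_) hUd.ne_zero
    split_ifs <;> simp [hz]
  · rw [map_mul, hd, ha]
    have h1 := Matrix.adjugate_mul ((auxT G l).map e)
    nth_rewrite 2 [hT] at h1
    have h2 := congrArg (· * M⁻¹) h1
    simp only [Matrix.mul_assoc, Matrix.mul_nonsing_inv M hUd, Matrix.mul_one] at h2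
    have h3 := congrFun (congrFun h2 o) o
    simp [Matrix.mul_diagonal, hol] at h3
    rw [← h3, he]
    simp [mul_comm]

open MvPolynomial in
theorem auxT_zero {n : ℕ} (G : SimpleGraph (Fin n)) [DecidableRel G.Adj] (l : Fin n)
    (hl : ∀ i, i ≤ l) (v : Fin 2 → ℂ) (hv : v 0 = 0) :
    eval v (auxT G l).det = - v 1 := by
  rw [RingHom.map_det, Matrix.det_of_lowerTriangular]
  · rw [Finset.prod_eq_single l]
    · simp [auxT]
    · intro b _ hb
      simp [auxT, hb, hv]
    · simp
  · intro i j hij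
    have hij' : i < j := hij
    have : i ≠ l := (lt_of_lt_of_le hij' (hl j)).ne
    simp [auxT, this, hij'.ne]
    split_ifs <;> simp [hv]

open MvPolynomial in
theorem aux_core {n : ℕ} (G : SimpleGraph (Fin n)) [DecidableRel G.Adj] (l o : Fin n) (hol : o ≠ l)
    (hl : ∀ i, i ≤ l) (hreach : G.Reachable o l) :
    ∃ q₁ q₂ : MvPolynomial (Fin 2) ℂ,
      q₂ ≠ 0 ∧
      (∀ d : MvPolynomial (Fin 2) ℂ, d ∣ q₁ → d ∣ q₂ → IsUnit d) ∧
      eval (fun _ => (0 : ℂ)) q₁ = 0 ∧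
      eval (fun _ => (0 : ℂ)) q₂ = 0 ∧
      ∀ z₁ z₂ : ℂ, z₁ ≠ 0 → ∀ M : Matrix (Fin n) (Fin n) ℂ,
        M = G.adjMatrix ℂ - Matrix.diagonal (fun k : Fin n => if k = l then z₂ else -1 / z₁) →
        IsUnit M →
        eval (fun i : Fin 2 => if i = 0 then z₁ else z₂) q₂ * M⁻¹ o o =
          eval (fun i : Fin 2 => if i = 0 then z₁ else z₂) q₁ := by
  have hz := auxT_zero G l hl
  have hmain := auxT_main G l o hol
  have hdeg2 := aux_degreeOf_det l _ (auxT_deg G l)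
  have hdeg1 := auxT_adj_deg G l o
  have hQ10 : eval (fun _ => (0 : ℂ)) (X 0 * (auxT G l).adjugate o o) = 0 := by simp
  generalize (auxT G l).det = Q2 at *
  generalize X 0 * (auxT G l).adjugate o o = Q1 at *
  have hQ2 : Q2 ≠ 0 := by
    rintro rfl
    have := hz (fun i => if i = 0 then 0 else 1) (by simp)
    simp at this
  obtain ⟨q2, q1, g, hrel, h2, h1⟩ := UniqueFactorizationMonoid.exists_reduced_factors Q2 hQ2 Q1
  have hq2 : q2 ≠ 0 := by rintro rfl; simp at h2; exact hQ2 h2.symm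
  have hg : g ≠ 0 := by rintro rfl; simp at h2; exact hQ2 h2.symm
  have hfin : ∀ z₁ z₂ : ℂ, z₁ ≠ 0 → ∀ M : Matrix (Fin n) (Fin n) ℂ,
        M = G.adjMatrix ℂ - Matrix.diagonal (fun k : Fin n => if k = l then z₂ else -1 / z₁) →
        IsUnit M →
        eval (fun i : Fin 2 => if i = 0 then z₁ else z₂) q2 ≠ 0 ∧
        eval (fun i : Fin 2 => if i = 0 then z₁ else z₂) q2 * M⁻¹ o o =
          eval (fun i : Fin 2 => if i = 0 then z₁ else z₂) q1 := by
    intro z₁ z₂ hz1 M hM hU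
    obtain ⟨ha, hb⟩ := hmain z₁ z₂ hz1 M hM hU
    rw [← h2, map_mul] at ha hb
    rw [← h1, map_mul, mul_assoc] at hb
    exact ⟨right_ne_zero_of_mul ha, mul_left_cancel₀ (left_ne_zero_of_mul ha) hb⟩
  have hg0 : eval (fun _ => (0 : ℂ)) g ≠ 0 := by
    intro hg0
    have hgdeg : 1 ≤ degreeOf 1 g := by
      by_contra! hlt
      have h3 := aux_eval_indep g (by omega) (fun _ => 0) (fun i => if i = 0 then 0 else 1) (by simp)
      have h4 := hz (fun i => if i = 0 then 0 else 1) (by simp)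
      rw [← h2, map_mul, ← h3, hg0] at h4
      simp at h4
    have d2 : degreeOf 1 q2 = 0 := by
      rw [← h2, degreeOf_mul_eq hg hq2] at hdeg2
      omega
    have d1 : degreeOf 1 q1 = 0 := by
      by_cases hq1 : q1 = 0
      · simp [hq1]
      rw [← h1, degreeOf_mul_eq hg hq1] at hdeg1
      omega
    have hnp : (0:ℝ) < (n:ℝ) + 1 := by positivity
    have hnc : ((n:ℂ) + 1) ≠ 0 := by exact_mod_cast hnp.ne'
    have key : ∀ s : ℝ, (n:ℝ) < s → ∃ M : Matrix (Fin n) (Fin n) ℂ,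
        M = G.adjMatrix ℂ - Matrix.diagonal (fun k : Fin n => if k = l then (s:ℂ) else (n:ℂ) + 1) ∧
        IsUnit M ∧ M⁻¹ l o ≠ 0 ∧ M⁻¹ o l ≠ 0 ∧
        eval (fun i : Fin 2 => if i = 0 then -1 / ((n:ℂ) + 1) else 0) q2 ≠ 0 ∧
        eval (fun i : Fin 2 => if i = 0 then -1 / ((n:ℂ) + 1) else 0) q2 * M⁻¹ o o =
          eval (fun i : Fin 2 => if i = 0 then -1 / ((n:ℂ) + 1) else 0) q1 := by
      intro s hs
      refine ⟨_, rfl, ?_⟩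
      obtain ⟨a, b, c⟩ := aux_mat G o l hreach (fun k => if k = l then s else n + 1)
        (by intro i; split_ifs <;> linarith)
        (G.adjMatrix ℂ - Matrix.diagonal (fun k : Fin n => if k = l then (s:ℂ) else (n:ℂ) + 1))
        (by congr 2; funext k; split_ifs <;> simp)
      refine ⟨a, b, c, ?_⟩
      have := hfin (-1 / ((n:ℂ) + 1)) s (div_ne_zero (by norm_num) hnc) _
        (by congr 2; funext k; congr 1; field_simp) a
      rwa [aux_eval_indep q2 d2 _ (fun i : Fin 2 => if i = 0 then -1 / ((n:ℂ) + 1) else 0) (by simp),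
        aux_eval_indep q1 d1 _ (fun i : Fin 2 => if i = 0 then -1 / ((n:ℂ) + 1) else 0) (by simp)] at this
    obtain ⟨M, hM, hMU, -, hM1, hne, hMe⟩ := key (n + 1) (by linarith)
    obtain ⟨N, hN, hNU, hN1, -, -, hNe⟩ := key (n + 2) (by linarith)
    have heq : M⁻¹ o o = N⁻¹ o o := mul_left_cancel₀ hne (hMe.trans hNe.symm)
    have hMd := (Matrix.isUnit_iff_isUnit_det M).mp hMU
    have hNd := (Matrix.isUnit_iff_isUnit_det N).mp hNU
    have hdiff : M - N = Matrix.diagonal (fun k => if k = l then (1:ℂ) else 0) := by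
      rw [hM, hN, sub_sub_sub_cancel_left, Matrix.diagonal_sub]
      congr 1; funext k; split_ifs
      · push_cast; ring
      · ring
    have hres : M⁻¹ * (M - N) * N⁻¹ = N⁻¹ - M⁻¹ := by
      rw [Matrix.mul_sub, Matrix.sub_mul, Matrix.nonsing_inv_mul M hMd, Matrix.mul_assoc,
        Matrix.mul_nonsing_inv N hNd]; simp
    rw [hdiff] at hres
    have h5 := congrFun (congrFun hres o) o
    rw [Matrix.sub_apply, heq, sub_self, Matrix.mul_apply] at h5
    simp [Matrix.mul_diagonal] at h5
    exact h5.elim hM1 hN1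
  refine ⟨q1, q2, hq2, fun d hd1 hd2 => hrel hd2 hd1, ?_, ?_, fun z₁ z₂ hz1 M hM hU =>
    (hfin z₁ z₂ hz1 M hM hU).2⟩
  · rw [← h1, map_mul] at hQ10
    exact (mul_eq_zero.mp hQ10).resolve_left hg0
  · have := hz (fun _ => 0) rfl
    rw [← h2, map_mul, neg_zero] at this
    exact (mul_eq_zero.mp this).resolve_left hg0

/-- For a simple graph `G` on `{1, …, n}` (`n ≥ 2`) whose vertices `1` and
`n` are path connected, the function `h_A(z₁, z₂) = ((A - ẑ_Y)⁻¹)₁₁` (where `ẑ_Y` is the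
diagonal matrix `diag(-1/z₁, …, -1/z₁, z₂)`) can be written in lowest terms `q₁/q₂` with
`q₁(0,0) = 0 = q₂(0,0)`. -/
theorem lowest_terms_vanish_at_origin (n : ℕ) (hn : 2 ≤ n)
    (G : SimpleGraph (Fin n)) [DecidableRel G.Adj]
    (hreach : G.Reachable ⟨0, by omega⟩ ⟨n - 1, by omega⟩) :
    ∃ q₁ q₂ : MvPolynomial (Fin 2) ℂ,
      q₂ ≠ 0 ∧
      (∀ d : MvPolynomial (Fin 2) ℂ, d ∣ q₁ → d ∣ q₂ → IsUnit d) ∧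
      MvPolynomial.eval (fun _ => (0 : ℂ)) q₁ = 0 ∧
      MvPolynomial.eval (fun _ => (0 : ℂ)) q₂ = 0 ∧
      ∀ z₁ z₂ : ℂ, z₁ ≠ 0 →
        let M : Matrix (Fin n) (Fin n) ℂ := G.adjMatrix ℂ -
          Matrix.diagonal (fun k : Fin n => if k.1 = n - 1 then z₂ else -1 / z₁)
        IsUnit M →
        MvPolynomial.eval (fun i : Fin 2 => if i = 0 then z₁ else z₂) q₂ ≠ 0 →
        MvPolynomial.eval (fun i : Fin 2 => if i = 0 then z₁ else z₂) q₂ *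
            (M⁻¹ ⟨0, by omega⟩ ⟨0, by omega⟩) =
          MvPolynomial.eval (fun i : Fin 2 => if i = 0 then z₁ else z₂) q₁ := by
  obtain ⟨q₁, q₂, h1, h2, h3, h4, h5⟩ := aux_core G ⟨n - 1, by omega⟩ ⟨0, by omega⟩
    (by simp [Fin.ext_iff]; omega) (by intro i; have := i.2; simp [Fin.le_def]; omega) hreach
  refine ⟨q₁, q₂, h1, h2, h3, h4, fun z₁ z₂ hz => ?_⟩
  intro M hU _
  refine h5 z₁ z₂ hz M ?_ hU
  simp only [M, Fin.ext_iff]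
end

section
/- Let a₁, a₂, k ∈ ℕ with a₁ > k and a₂ ≥ k. Then ∑_{m=0}^{k} C(a₁ − m, m)·C(a₂ − (k − m), k − m) = ∑_{m=0}^{k} C(a₁ − 1 − m, m)·C(a₂ + 1 − (k − m), k − m), where C(a, b) denotes the binomial coefficient, with the convention C(a, b) = 0 whenever a < b. -/
lemma aux_pascal (a m : ℕ) (h : m ≤ a) :
    Nat.choose (a + 2 - (m + 1)) (m + 1) =
      Nat.choose (a + 1 - (m + 1)) (m + 1) + Nat.choose (a - m) m := by
  have e1 : a + 2 - (m + 1) = (a - m) + 1 := by omega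
  have e2 : a + 1 - (m + 1) = a - m := by omega
  rw [e1, e2, Nat.choose_succ_succ]
  ring

lemma aux_shift (k : ℕ) : ∀ a b : ℕ, k ≤ a → k ≤ b →
    ∑ p ∈ Finset.HasAntidiagonal.antidiagonal k, Nat.choose (a + 1 - p.1) p.1 * Nat.choose (b - p.2) p.2 =
    ∑ p ∈ Finset.HasAntidiagonal.antidiagonal k, Nat.choose (a - p.1) p.1 * Nat.choose (b + 1 - p.2) p.2 := by
  induction k with
  | zero => intro a b _ _; simp
  | succ k ih =>
    intro a b ha hb
    obtain ⟨a, rfl⟩ : ∃ c, a = c + 1 := ⟨a - 1, by omega⟩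
    obtain ⟨b, rfl⟩ : ∃ c, b = c + 1 := ⟨b - 1, by omega⟩
    have hL : ∑ p ∈ Finset.HasAntidiagonal.antidiagonal (k + 1),
        Nat.choose (a + 1 + 1 - p.1) p.1 * Nat.choose (b + 1 - p.2) p.2 =
        ∑ p ∈ Finset.HasAntidiagonal.antidiagonal (k + 1),
          Nat.choose (a + 1 - p.1) p.1 * Nat.choose (b + 1 - p.2) p.2 +
        ∑ p ∈ Finset.HasAntidiagonal.antidiagonal k,
          Nat.choose (a - p.1) p.1 * Nat.choose (b + 1 - p.2) p.2 := by
      rw [Finset.Nat.sum_antidiagonal_succ, Finset.Nat.sum_antidiagonal_succ,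
        add_assoc (Nat.choose _ _ * Nat.choose _ _),
        ← Finset.sum_add_distrib]
      congr 1
      · refine Finset.sum_congr rfl fun p hp => ?_
        have := Finset.HasAntidiagonal.mem_antidiagonal.1 hp
        rw [aux_pascal a p.1 (by omega), add_mul]
    have hR : ∑ p ∈ Finset.HasAntidiagonal.antidiagonal (k + 1),
        Nat.choose (a + 1 - p.1) p.1 * Nat.choose (b + 1 + 1 - p.2) p.2 =
        ∑ p ∈ Finset.HasAntidiagonal.antidiagonal (k + 1),
          Nat.choose (a + 1 - p.1) p.1 * Nat.choose (b + 1 - p.2) p.2 +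
        ∑ p ∈ Finset.HasAntidiagonal.antidiagonal k,
          Nat.choose (a + 1 - p.1) p.1 * Nat.choose (b - p.2) p.2 := by
      rw [Finset.Nat.sum_antidiagonal_succ', Finset.Nat.sum_antidiagonal_succ',
        add_assoc (Nat.choose _ _ * Nat.choose _ _), ← Finset.sum_add_distrib]
      congr 1
      · refine Finset.sum_congr rfl fun p hp => ?_
        have := Finset.HasAntidiagonal.mem_antidiagonal.1 hp
        rw [aux_pascal b p.2 (by omega), mul_add]
    rw [hL, hR, ih a b (by omega) (by omega)]

/-- Lemma 3.6 of the paper.  For `a₁ > k` and `a₂ ≥ k`,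
`∑_{m=0}^{k} C(a₁ - m, m) C(a₂ - (k - m), k - m)
  = ∑_{m=0}^{k} C(a₁ - 1 - m, m) C(a₂ + 1 - (k - m), k - m)`,
where `C(a, b) = Nat.choose a b` (which is `0` when `a < b`). -/
theorem binomial_sum_shift (a₁ a₂ k : ℕ) (h₁ : k < a₁) (h₂ : k ≤ a₂) :
    ∑ m ∈ Finset.range (k + 1),
        Nat.choose (a₁ - m) m * Nat.choose (a₂ - (k - m)) (k - m) =
      ∑ m ∈ Finset.range (k + 1),
        Nat.choose (a₁ - 1 - m) m * Nat.choose (a₂ + 1 - (k - m)) (k - m) := by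
  obtain ⟨a, rfl⟩ : ∃ c, a₁ = c + 1 := ⟨a₁ - 1, by omega⟩
  have h := aux_shift k a a₂ (by omega) h₂
  rw [Finset.Nat.sum_antidiagonal_eq_sum_range_succ_mk,
    Finset.Nat.sum_antidiagonal_eq_sum_range_succ_mk] at h
  simpa using h
end

section
/- For k ≥ 1 let P_k denote the k×k adjacency matrix of the path graph on k vertices, i.e., (P_k)_{ij} = 1 if |i − j| = 1 and 0 otherwise, and let χ_k(z) := det(P_k − z·I_k). Then for every n ≥ 2 and every z ∈ ℂ, χ_n(z)² − χ_{n+1}(z)·χ_{n−1}(z) = 1. -/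
/-- The `k × k` adjacency matrix of the path graph on `k` vertices:
`(P_k)_{ij} = 1` iff `|i - j| = 1`. -/
def pathAdjMatrix (k : ℕ) : Matrix (Fin k) (Fin k) ℂ :=
  Matrix.of fun i j => if i.1 + 1 = j.1 ∨ j.1 + 1 = i.1 then 1 else 0

/-- `χ_k(z) = det(P_k - z I_k)`. -/
noncomputable def pathCharDet (k : ℕ) (z : ℂ) : ℂ :=
  (pathAdjMatrix k - z • (1 : Matrix (Fin k) (Fin k) ℂ)).det

theorem pathCharDet_rec (k : ℕ) (z : ℂ) :
    pathCharDet (k + 2) z = -z * pathCharDet (k + 1) z - pathCharDet k z := by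
  unfold pathCharDet
  rw [Matrix.det_succ_row_zero, Fin.sum_univ_succ, Fin.sum_univ_succ,
    Finset.sum_eq_zero (s := Finset.univ) (f := fun i : Fin k => _), add_zero]
  · have h1 : (pathAdjMatrix (k + 2) - z • (1 : Matrix (Fin (k + 2)) (Fin (k + 2)) ℂ)).submatrix
        Fin.succ (Fin.succAbove 0) = pathAdjMatrix (k + 1) - z • 1 := by
      ext i j
      simp [pathAdjMatrix, Matrix.one_apply]
    have h2 : ((pathAdjMatrix (k + 2) - z • (1 : Matrix (Fin (k + 2)) (Fin (k + 2)) ℂ)).submatrix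
        Fin.succ (Fin.succAbove (Fin.succ 0))).det = (pathAdjMatrix k - z • 1).det := by
      rw [Matrix.det_succ_column_zero, Fin.sum_univ_succ, Finset.sum_eq_zero, add_zero]
      · have h3 : ((pathAdjMatrix (k + 2) - z • (1 : Matrix (Fin (k + 2)) (Fin (k + 2)) ℂ)).submatrix
          Fin.succ (Fin.succAbove (Fin.succ 0))).submatrix (Fin.succAbove 0) Fin.succ
            = pathAdjMatrix k - z • 1 := by
          ext i j
          simp [pathAdjMatrix, Matrix.one_apply]
        rw [h3]
        simp [pathAdjMatrix, Matrix.one_apply]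
      · intro i _
        simp [pathAdjMatrix, Matrix.one_apply, Fin.ext_iff]
    rw [h1, h2]
    simp [pathAdjMatrix, Matrix.one_apply, Fin.ext_iff]
    ring
  · intro i _
    simp [pathAdjMatrix, Matrix.one_apply, Fin.ext_iff]

theorem pathCharDet_aux (k : ℕ) (z : ℂ) :
    pathCharDet (k + 1) z ^ 2 - pathCharDet (k + 2) z * pathCharDet k z = 1 := by
  induction k with
  | zero =>
    rw [pathCharDet_rec]
    have h0 : pathCharDet 0 z = 1 := by simp [pathCharDet]
    have h1 : pathCharDet 1 z = -z := by simp [pathCharDet, pathAdjMatrix]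
    simp only [zero_add, h0, h1]
    ring
  | succ k ih =>
    have e := pathCharDet_rec (k + 1) z
    have e' := pathCharDet_rec k z
    rw [show k + 1 + 2 = k + 3 from rfl, show k + 1 + 1 = k + 2 from rfl] at *
    rw [e, ← ih, e']
    ring

/-- The determinant identity `χ_n(z)² - χ_{n+1}(z) χ_{n-1}(z) = 1`
for `n ≥ 2`, underlying the contact order `2(n-1)` computation for path graphs. -/
theorem pathCharDet_sq_sub_mul (n : ℕ) (hn : 2 ≤ n) (z : ℂ) :
    pathCharDet n z ^ 2 - pathCharDet (n + 1) z * pathCharDet (n - 1) z = 1 := by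
  obtain ⟨k, rfl⟩ : ∃ k, n = k + 1 := ⟨n - 1, by omega⟩
  exact pathCharDet_aux k z
end

section
/- For k ≥ 1 let P_k denote the k×k adjacency matrix of the path graph on k vertices, i.e., (P_k)_{ij} = 1 if |i − j| = 1 and 0 otherwise, and let χ_k(z) := det(P_k − z·I_k). Fix n ≥ 4 and z₁, z₂ ∈ ℂ, let Z be the n×n diagonal matrix with diagonal entries (z₁, …, z₁, z₂), and suppose z₂·χ_{n−1}(z₁) + χ_{n−2}(z₁) ≠ 0. Then P_n − Z is invertible and ((P_n − Z)⁻¹)₁₁ = (z₂·χ_{n−2}(z₁) + χ_{n−3}(z₁)) / (z₂·χ_{n−1}(z₁) + χ_{n−2}(z₁)). -/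
def triD (k : ℕ) (d : ℕ → ℂ) : Matrix (Fin k) (Fin k) ℂ :=
  Matrix.of fun i j => if i.1 = j.1 then d i.1 else
    if i.1 + 1 = j.1 ∨ j.1 + 1 = i.1 then 1 else 0

theorem triD_rec (m : ℕ) (d : ℕ → ℂ) :
    (triD (m+2) d).det = d (m+1) * (triD (m+1) d).det - (triD m d).det := by
  have h1 : (triD (m+2) d).submatrix Fin.castSucc Fin.castSucc = triD (m+1) d := by
    ext i j; simp [triD]
  have h2 : ((triD (m+2) d).submatrix Fin.castSucc
      (Fin.castSucc (Fin.last m)).succAbove).det = (triD m d).det := by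
    rw [Matrix.det_succ_column _ (Fin.last m), Fin.sum_univ_castSucc,
      Finset.sum_eq_zero]
    · have h3 : ((triD (m+2) d).submatrix Fin.castSucc
        (Fin.castSucc (Fin.last m)).succAbove).submatrix (Fin.last m).succAbove
          (Fin.last m).succAbove = triD m d := by
        ext i j
        have : (Fin.castSucc (Fin.last m)).succAbove (Fin.castSucc j)
            = Fin.castSucc (Fin.castSucc j) :=
          Fin.succAbove_of_castSucc_lt _ _ (by simp [Fin.lt_def])
        simp [triD, this]
      rw [h3]
      have : (-1 : ℂ) ^ (m + m) = 1 := Even.neg_one_pow ⟨m, rfl⟩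
      simp [triD, this]
    · intro i _
      have := i.2
      have e : triD (m+2) d i.castSucc.castSucc (Fin.last (m+1)) = 0 := by
        simp only [triD, Matrix.of_apply, Fin.val_castSucc, Fin.val_last]
        rw [if_neg (by omega), if_neg (by omega)]
      simp [e]
  rw [Matrix.det_succ_row _ (Fin.last (m+1)), Fin.sum_univ_castSucc,
    Fin.sum_univ_castSucc, Finset.sum_eq_zero]
  · rw [Fin.succAbove_last, h1, h2]
    have e1 : (-1 : ℂ) ^ (m + 1 + (m + 1)) = 1 := Even.neg_one_pow ⟨_, rfl⟩
    have e2 : (-1 : ℂ) ^ (m + 1 + m) = -1 := Odd.neg_one_pow ⟨m, by ring⟩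
    simp [triD, e1, e2]
    ring
  · intro i _
    have := i.2
    have e : triD (m+2) d (Fin.last (m+1)) i.castSucc.castSucc = 0 := by
      simp only [triD, Matrix.of_apply, Fin.val_castSucc, Fin.val_last]
      rw [if_neg (by omega), if_neg (by omega)]
    simp [e]

theorem triD_congr (k : ℕ) (d e : ℕ → ℂ) (h : ∀ i < k, d i = e i) : triD k d = triD k e := by
  ext i j
  simp [triD, h i.1 i.2]

theorem pathCharDet_eq (k : ℕ) (z : ℂ) : pathCharDet k z = (triD k fun _ => -z).det := by
  unfold pathCharDet
  congr 1
  ext i j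
  by_cases h : i = j
  · subst h; simp [triD, pathAdjMatrix]
  · simp [triD, pathAdjMatrix, h, Fin.val_inj]

theorem triD_last (m : ℕ) (z₁ z₂ : ℂ) :
    (triD (m+2) fun i => if i = m + 1 then -z₂ else -z₁).det =
      -(z₂ * pathCharDet (m+1) z₁ + pathCharDet m z₁) := by
  rw [triD_rec, pathCharDet_eq, pathCharDet_eq,
    triD_congr (m+1) _ (fun _ => -z₁) (fun i hi => if_neg (by omega)),
    triD_congr m _ (fun _ => -z₁) (fun i hi => if_neg (by omega))]
  simp
  ring

/-- For the `n`-vertex path graph (`n ≥ 4`) and `Z = diag(z₁,…,z₁,z₂)`,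
if `z₂ χ_{n-1}(z₁) + χ_{n-2}(z₁) ≠ 0` then `P_n - Z` is invertible and
`((P_n - Z)⁻¹)₁₁ = (z₂ χ_{n-2}(z₁) + χ_{n-3}(z₁)) / (z₂ χ_{n-1}(z₁) + χ_{n-2}(z₁))`. -/
theorem pathGraph_inv_entry_formula (n : ℕ) (hn : 4 ≤ n) (z₁ z₂ : ℂ)
    (hden : z₂ * pathCharDet (n - 1) z₁ + pathCharDet (n - 2) z₁ ≠ 0) :
    let Z : Matrix (Fin n) (Fin n) ℂ :=
      Matrix.diagonal fun i => if i.1 = n - 1 then z₂ else z₁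
    IsUnit (pathAdjMatrix n - Z) ∧
      (pathAdjMatrix n - Z)⁻¹ ⟨0, by omega⟩ ⟨0, by omega⟩ =
        (z₂ * pathCharDet (n - 2) z₁ + pathCharDet (n - 3) z₁) /
          (z₂ * pathCharDet (n - 1) z₁ + pathCharDet (n - 2) z₁) := by
  obtain ⟨m, rfl⟩ : ∃ m, n = m + 3 := ⟨n - 3, by omega⟩
  intro Z
  have hZ : pathAdjMatrix (m+3) - Z = triD (m+3) fun i => if i = m + 2 then -z₂ else -z₁ := by
    ext i j
    by_cases h : i = j
    · subst h
      by_cases h' : i.1 = m + 2 <;> simp [Z, triD, pathAdjMatrix, h']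
    · simp [Z, triD, pathAdjMatrix, h, Fin.val_inj]
  have hdet := triD_last (m+1) z₁ z₂
  have hmin : ((triD (m+3) fun i => if i = m + 2 then -z₂ else -z₁).submatrix
      Fin.succ Fin.succ) = triD (m+2) fun i => if i = m + 1 then -z₂ else -z₁ := by
    ext i j
    simp [triD]
  have hdet2 := triD_last m z₁ z₂
  have e1 : m + 3 - 1 = m + 2 := rfl
  have e2 : m + 3 - 2 = m + 1 := rfl
  have e3 : m + 3 - 3 = m := rfl
  rw [e1, e2] at hden
  rw [e1, e2, e3, hZ]
  refine ⟨(Matrix.isUnit_iff_isUnit_det _).2 ?_, ?_⟩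
  · rw [isUnit_iff_ne_zero, hdet]
    exact neg_ne_zero.2 hden
  · change (triD (m+3) fun i => if i = m + 2 then -z₂ else -z₁)⁻¹ 0 0 = _
    rw [Matrix.inv_def, Matrix.smul_apply, Matrix.adjugate_fin_succ_eq_det_submatrix,
      Fin.succAbove_zero, hmin, hdet, hdet2, Ring.inverse_eq_inv']
    simp only [Fin.val_zero, add_zero, pow_zero, one_mul, smul_eq_mul]
    rw [inv_neg, neg_mul_neg, div_eq_mul_inv, mul_comm]
end
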